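/- Let ε > 0, let K be a positive integer, and for y ∈ [K] let P_y denote the probability distribution on subsets S ⊆ [K] obtained by including each i ∈ [K] in S independently with probability 1/2 if i = y and probability 1/(e^ε + 1) if i ≠ y. Then for all y, y' ∈ [K] and every subset S ⊆ [K], the likelihood ratio P_y(S)/P_{y'}(S) equals 1 if y and y' are both in S or both not in S, equals e^ε if y ∈ S and y' ∉ S, and equals e^{-ε} if y ∉ S and y' ∈ S. In particular, P_y(S) ≤ e^ε · P_{y'}(S) for all y, y', S. -/

import Mathlib

open Finset

/-- The subset randomizer: each `i ∈ [K]` is included in the output set independently with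
probability `1/2` if `i = y` and probability `1/(e^ε + 1)` otherwise. `subsetProb ε y S` is the
probability that the output is exactly `S`. -/
noncomputable def subsetProb (ε : ℝ) {K : ℕ} (y : Fin K) (S : Finset (Fin K)) : ℝ :=
  (∏ i ∈ S, if i = y then (1 : ℝ) / 2 else 1 / (Real.exp ε + 1)) *
    ∏ i ∈ Sᶜ, (1 - if i = y then (1 : ℝ) / 2 else 1 / (Real.exp ε + 1))

theorem aux_prod {K : ℕ} (y : Fin K) (T : Finset (Fin K)) (a b : ℝ) (hb : b ≠ 0) :
    (∏ i ∈ T, if i = y then a else b) = b ^ T.card * if y ∈ T then a / b else 1 := by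
  have h : ∀ i ∈ T, (if i = y then a else b) = b * (if i = y then a / b else 1) := by
    intro i _
    split_ifs <;> field_simp
  rw [Finset.prod_congr rfl h, Finset.prod_mul_distrib, Finset.prod_const, Finset.prod_ite_eq']

theorem aux_form (ε : ℝ) {K : ℕ} (S : Finset (Fin K)) :
    ∃ C : ℝ, 0 < C ∧ ∀ y : Fin K,
      subsetProb ε y S = C * if y ∈ S then Real.exp ε else 1 := by
  have he := Real.exp_pos ε
  have hq : (1 : ℝ) / (Real.exp ε + 1) ≠ 0 := by positivity
  have hr : (1 : ℝ) - 1 / (Real.exp ε + 1) = Real.exp ε / (Real.exp ε + 1) := by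
    field_simp
    ring
  have hr' : Real.exp ε / (Real.exp ε + 1) ≠ 0 := by positivity
  refine ⟨(1 / (Real.exp ε + 1)) ^ S.card * (Real.exp ε / (Real.exp ε + 1)) ^ Sᶜ.card *
    ((Real.exp ε + 1) / (2 * Real.exp ε)), by positivity, fun y => ?_⟩
  have h1 : ∀ i ∈ Sᶜ, (1 - if i = y then (1 : ℝ) / 2 else 1 / (Real.exp ε + 1)) =
      if i = y then (1 : ℝ) / 2 else Real.exp ε / (Real.exp ε + 1) := by
    intro i _
    split_ifs
    · norm_num
    · exact hr
  unfold subsetProb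
  rw [Finset.prod_congr rfl h1, aux_prod _ _ _ _ hq, aux_prod _ _ _ _ hr']
  simp only [Finset.mem_compl]
  generalize (1 / (Real.exp ε + 1)) ^ S.card = A
  generalize (Real.exp ε / (Real.exp ε + 1)) ^ Sᶜ.card = B
  by_cases h : y ∈ S <;> simp only [h, if_true, if_false, not_true, not_false_eq_true] <;>
    field_simp

theorem stmt_0 (ε : ℝ) (hε : 0 < ε) (K : ℕ) (hK : 0 < K) (y y' : Fin K)
    (S : Finset (Fin K)) :
    (((y ∈ S ∧ y' ∈ S) ∨ (y ∉ S ∧ y' ∉ S)) →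
      subsetProb ε y S / subsetProb ε y' S = 1) ∧
    ((y ∈ S ∧ y' ∉ S) → subsetProb ε y S / subsetProb ε y' S = Real.exp ε) ∧
    ((y ∉ S ∧ y' ∈ S) → subsetProb ε y S / subsetProb ε y' S = Real.exp (-ε)) ∧
    subsetProb ε y S ≤ Real.exp ε * subsetProb ε y' S := by
  obtain ⟨C, hC, h⟩ := aux_form ε S
  have he := Real.exp_pos ε
  have h1 : 1 ≤ Real.exp ε := Real.one_le_exp hε.le
  rw [h y, h y']
  refine ⟨?_, ?_, ?_, ?_⟩
  · rintro (⟨a, b⟩ | ⟨a, b⟩)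
    · rw [if_pos a, if_pos b]
      field_simp
    · rw [if_neg a, if_neg b]
      field_simp
  · rintro ⟨a, b⟩
    rw [if_pos a, if_neg b]
    field_simp
  · rintro ⟨a, b⟩
    rw [if_neg a, if_pos b, Real.exp_neg]
    field_simp
  · rw [mul_left_comm]
    refine mul_le_mul_of_nonneg_left ?_ hC.le
    split_ifs <;> nlinarith
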